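/- Let X ⊂ ℝ^d be compact and convex, Ω ⊆ X Borel, p > 1, p' = p/(p−1), and let μ, λ be measures with λ(Ω) = μ(Ω), λ absolutely continuous with respect to Lebesgue measure, and μ supported on Y ⊆ X closed. Let π ∈ C(μ,λ) and v ∈ S(b_Ω^p, Y) be optimizers of Wb^p_Ω(μ,λ) in the primal and dual formulations, and set u := Q_{b_Ω^p}(v) and ℓ := ( osc_Y(v) + d(X,Y)^p )^{1/p}. Then ∫_Ω |∇u|^{p'} dλ ≤ p^{p'} Wb^p_Ω(μ,λ), and for π-a.e. (x,y): if x ∈ Ω^{(ℓ)} then y = x − ( ∇u(x)/p )^{(p'/p)}. -/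

import Mathlib

open MeasureTheory Metric Set Filter
open scoped ENNReal NNReal Topology

noncomputable section

/-- The set of couplings between two measures: Borel measures on the product whose
first marginal is `lam` and second marginal is `μ`. -/
def couplings {X : Type*} [MeasurableSpace X] (μ lam : Measure X) : Set (Measure (X × X)) :=
  {π | π.map Prod.fst = lam ∧ π.map Prod.snd = μ}

/-- Optimal transport cost for a cost function `c` (extended-real valued). -/
def transportCostE {X : Type*} [MeasurableSpace X] (c : X → X → ℝ) (μ lam : Measure X) : ℝ≥0∞ :=
  ⨅ π ∈ couplings μ lam, ∫⁻ z, ENNReal.ofReal (c z.1 z.2) ∂π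

/-- Optimal transport cost for a cost function `c` (real valued). -/
def transportCost {X : Type*} [MeasurableSpace X] (c : X → X → ℝ) (μ lam : Measure X) : ℝ :=
  (transportCostE c μ lam).toReal

/-- The boundary pseudo-distance `b_Ω(x,y) = min{|x−y|, (d(x,Ω^c)^p + d(y,Ω^c)^p)^{1/p}}`. -/
def bdist {X : Type*} [PseudoMetricSpace X] (p : ℝ) (Ω : Set X) (x y : X) : ℝ :=
  min (dist x y) ((infDist x Ωᶜ ^ p + infDist y Ωᶜ ^ p) ^ (1 / p))

/-- Boundary transport cost `Wb^p_Ω(μ, λ)` (between the restrictions to `Ω`). -/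
def Wb {X : Type*} [MeasurableSpace X] [PseudoMetricSpace X] (p : ℝ) (Ω : Set X)
    (μ lam : Measure X) : ℝ :=
  transportCost (fun x y => bdist p Ω x y ^ p) (μ.restrict Ω) (lam.restrict Ω)

/-- The cost transform `Q_{b_Ω^p}(v)(x) = inf_{y ∈ Y} (v(y) + b_Ω(x,y)^p)`. -/
def Qb {X : Type*} [PseudoMetricSpace X] (p : ℝ) (Ω Y : Set X) (v : X → ℝ) (x : X) : ℝ :=
  ⨅ y : Y, (v ↑y + bdist p Ω x ↑y ^ p)

/-- The dual transform `Q̂_{b_Ω^p}(u)(y) = sup_{x ∈ K} (u(x) − b_Ω(x,y)^p)` (ambient set `K`). -/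
def Qbhat {X : Type*} [PseudoMetricSpace X] (p : ℝ) (Ω K : Set X) (u : X → ℝ) (y : X) : ℝ :=
  ⨆ x : K, (u ↑x - bdist p Ω ↑x y ^ p)

/-- `S(b_Ω^p, Y)`: functions on `Y` which are dual transforms of some `u`. -/
def memS {X : Type*} [PseudoMetricSpace X] (p : ℝ) (Ω K Y : Set X) (v : X → ℝ) : Prop :=
  ∃ u : X → ℝ, ∀ y ∈ Y, v y = Qbhat p Ω K u y

/-- oscillation of `v` on `Y`. -/
def oscOn {X : Type*} (Y : Set X) (v : X → ℝ) : ℝ := sSup (v '' Y) - sInf (v '' Y)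

/-- `d(A,B) = sup_{x ∈ A} inf_{y ∈ B} d(x,y)`. -/
def supInfDist {X : Type*} [PseudoMetricSpace X] (A B : Set X) : ℝ :=
  sSup ((fun x => infDist x B) '' A)

/-- `Ω^{(r)} = {x ∈ Ω : d(x, Ω^c) > r}`. -/
def innerPart {X : Type*} [PseudoMetricSpace X] (Ω : Set X) (r : ℝ) : Set X :=
  {x ∈ Ω | r < infDist x Ωᶜ}

/-- the vector power `z^{(α)} = |z|^{α-1} z`. -/
def vpow {d : ℕ} (z : EuclideanSpace ℝ (Fin d)) (α : ℝ) : EuclideanSpace ℝ (Fin d) :=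
  ‖z‖ ^ (α - 1) • z

section Real

theorem rpow_le_rpow_add_mul {p a b t R : ℝ} (hp : 1 < p) (ha : 0 ≤ a) (hb : 0 ≤ b)
    (ht : 0 ≤ t) (haR : a ≤ R) (hab : a ≤ b + t) :
    a ^ p ≤ b ^ p + p * R ^ (p - 1) * t := by
  have hR : 0 ≤ R := ha.trans haR
  rcases le_or_gt a b with h | h
  · have h1 := Real.rpow_le_rpow ha h (by linarith : 0 ≤ p)
    have h2 : 0 ≤ p * R ^ (p - 1) * t := by positivity
    linarith
  · have ha' : 0 < a := hb.trans_lt h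
    have hbern := one_add_mul_self_le_rpow_one_add (s := b / a - 1) (p := p)
      (by have : 0 ≤ b / a := by positivity
          linarith) hp.le
    rw [show 1 + (b / a - 1) = b / a by ring, Real.div_rpow hb ha,
      le_div_iff₀ (by positivity)] at hbern
    have hpow : a ^ p = a ^ (p - 1) * a := by
      rw [← Real.rpow_add_one ha'.ne']; ring_nf
    have hstep : (1 + p * (b / a - 1)) * a ^ p = a ^ p - p * a ^ (p - 1) * (a - b) := by
      rw [hpow]; field_simp; ring
    have hle : p * a ^ (p - 1) * (a - b) ≤ p * R ^ (p - 1) * t := by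
      gcongr
      all_goals linarith
    linarith

end Real

section BoundaryCost

variable {X : Type*} [PseudoMetricSpace X] {p : ℝ} {Ω : Set X}

theorem bdist_nonneg (x y : X) : 0 ≤ bdist p Ω x y :=
  le_min dist_nonneg (Real.rpow_nonneg (add_nonneg (Real.rpow_nonneg infDist_nonneg _)
    (Real.rpow_nonneg infDist_nonneg _)) _)

theorem bdist_rpow (hp : 0 < p) (x y : X) :
    bdist p Ω x y ^ p = min (dist x y ^ p) (infDist x Ωᶜ ^ p + infDist y Ωᶜ ^ p) := by
  have h0 : 0 ≤ infDist x Ωᶜ ^ p + infDist y Ωᶜ ^ p :=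
    add_nonneg (Real.rpow_nonneg infDist_nonneg _) (Real.rpow_nonneg infDist_nonneg _)
  have h1 : ((infDist x Ωᶜ ^ p + infDist y Ωᶜ ^ p) ^ (1 / p)) ^ p
      = infDist x Ωᶜ ^ p + infDist y Ωᶜ ^ p := by
    rw [one_div, Real.rpow_inv_rpow h0 hp.ne']
  have hmono : MonotoneOn (fun t : ℝ => t ^ p) (Ici 0) :=
    Real.monotoneOn_rpow_Ici_of_exponent_nonneg hp.le
  rw [bdist]
  conv_rhs => rw [← h1]
  exact hmono.map_min dist_nonneg (Real.rpow_nonneg h0 _)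

theorem bdist_rpow_nonneg (x y : X) : 0 ≤ bdist p Ω x y ^ p :=
  Real.rpow_nonneg (bdist_nonneg x y) p

theorem continuous_bdist_rpow (hp : 0 < p) :
    Continuous fun z : X × X => bdist p Ω z.1 z.2 ^ p := by
  simp_rw [bdist_rpow hp]
  refine Continuous.min ?_ (Continuous.add ?_ ?_)
  · exact (continuous_fst.dist continuous_snd).rpow_const fun _ => Or.inr hp.le
  · exact ((continuous_infDist_pt _).comp continuous_fst).rpow_const fun _ => Or.inr hp.le
  · exact ((continuous_infDist_pt _).comp continuous_snd).rpow_const fun _ => Or.inr hp.le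

theorem bdist_comm (x y : X) : bdist p Ω x y = bdist p Ω y x := by
  rw [bdist, bdist, dist_comm, add_comm]

theorem exists_bdist_rpow_le_add {B : Set X} (hp : 1 < p) (hB : Bornology.IsBounded B) :
    ∃ K : ℝ≥0, ∀ x ∈ B, ∀ x' ∈ B, ∀ y ∈ B,
      bdist p Ω x y ^ p ≤ bdist p Ω x' y ^ p + K * dist x x' := by
  rcases B.eq_empty_or_nonempty with rfl | ⟨o, ho⟩
  · exact ⟨0, by simp⟩
  set R : ℝ := diam B + infDist o Ωᶜ
  have hR : 0 ≤ R := add_nonneg diam_nonneg infDist_nonneg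
  have hK : 0 ≤ p * R ^ (p - 1) := by positivity
  refine ⟨(p * R ^ (p - 1)).toNNReal, fun x hx x' hx' y hy => ?_⟩
  have hdist : dist x y ^ p ≤ dist x' y ^ p + p * R ^ (p - 1) * dist x x' := by
    refine rpow_le_rpow_add_mul hp dist_nonneg dist_nonneg dist_nonneg ?_ ?_
    · linarith [dist_le_diam_of_mem hB hx hy, infDist_nonneg (x := o) (s := Ωᶜ)]
    · linarith [dist_triangle x x' y]
  have hinf : infDist x Ωᶜ ^ p ≤ infDist x' Ωᶜ ^ p + p * R ^ (p - 1) * dist x x' := by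
    refine rpow_le_rpow_add_mul hp infDist_nonneg infDist_nonneg dist_nonneg ?_
      infDist_le_infDist_add_dist
    linarith [dist_le_diam_of_mem hB hx ho,
      infDist_le_infDist_add_dist (x := x) (y := o) (s := Ωᶜ)]
  rw [bdist_rpow (zero_lt_one.trans hp), bdist_rpow (zero_lt_one.trans hp), Real.coe_toNNReal _ hK]
  rcases min_choice (dist x' y ^ p) (infDist x' Ωᶜ ^ p + infDist y Ωᶜ ^ p) with h | h
  · rw [h]; exact (min_le_left _ _).trans hdist
  · rw [h]; exact (min_le_right _ _).trans (by linarith)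

/-- The boundary cost grows in its first variable at most like `t ↦ t ^ p` started at some
`a ≤ b_Ω(x, y)`. -/
theorem exists_bdist_rpow_sub_le (hp : 0 < p) (x y : X) :
    ∃ a, 0 ≤ a ∧ a ≤ bdist p Ω x y ∧
      ∀ x', bdist p Ω x' y ^ p - bdist p Ω x y ^ p ≤ (a + dist x' x) ^ p - a ^ p := by
  have hb := bdist_nonneg (p := p) (Ω := Ω) x y
  have hbp := bdist_rpow (Ω := Ω) hp x y
  rcases min_choice (dist x y ^ p) (infDist x Ωᶜ ^ p + infDist y Ωᶜ ^ p) with h | h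
  · rw [h] at hbp
    refine ⟨dist x y, dist_nonneg, (Real.rpow_le_rpow_iff dist_nonneg hb hp).1 hbp.ge,
      fun x' => ?_⟩
    rw [hbp, bdist_rpow hp]
    have h1 : dist x' y ^ p ≤ (dist x y + dist x' x) ^ p :=
      Real.rpow_le_rpow dist_nonneg (by linarith [dist_triangle x' x y]) hp.le
    linarith [min_le_left (dist x' y ^ p) (infDist x' Ωᶜ ^ p + infDist y Ωᶜ ^ p)]
  · rw [h] at hbp
    refine ⟨infDist x Ωᶜ, infDist_nonneg, (Real.rpow_le_rpow_iff infDist_nonneg hb hp).1 ?_,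
      fun x' => ?_⟩
    · linarith [Real.rpow_nonneg (infDist_nonneg (x := y) (s := Ωᶜ)) p]
    · rw [hbp, bdist_rpow hp]
      have h1 : infDist x' Ωᶜ ^ p ≤ (infDist x Ωᶜ + dist x' x) ^ p :=
        Real.rpow_le_rpow infDist_nonneg infDist_le_infDist_add_dist hp.le
      linarith [min_le_right (dist x' y ^ p) (infDist x' Ωᶜ ^ p + infDist y Ωᶜ ^ p)]

theorem Qb_le {Y : Set X} {v : X → ℝ} (hv : BddBelow (v '' Y)) (x : X) {y : X} (hy : y ∈ Y) :
    Qb p Ω Y v x ≤ v y + bdist p Ω x y ^ p := by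
  obtain ⟨m, hm⟩ := hv
  have hbdd : BddBelow (range fun y : Y => v y + bdist p Ω x y ^ p) :=
    ⟨m, by
      rintro _ ⟨y, rfl⟩
      have h1 := hm (mem_image_of_mem v y.2)
      have h2 := bdist_rpow_nonneg (p := p) (Ω := Ω) x (y : X)
      simp only
      linarith⟩
  exact ciInf_le hbdd ⟨y, hy⟩

theorem Qb_lipschitzOnWith {B Y : Set X} {K : ℝ≥0} {v : X → ℝ} (hYB : Y ⊆ B)
    (hK : ∀ x ∈ B, ∀ x' ∈ B, ∀ y ∈ B, bdist p Ω x y ^ p ≤ bdist p Ω x' y ^ p + K * dist x x')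
    (hv : BddBelow (v '' Y)) : LipschitzOnWith K (Qb p Ω Y v) B := by
  refine LipschitzOnWith.of_le_add_mul K fun x hx x' hx' => ?_
  rcases isEmpty_or_nonempty Y with hY | hY
  · simp only [Qb, Real.iInf_of_isEmpty, zero_add]; positivity
  rw [← sub_le_iff_le_add]
  refine le_ciInf fun y => ?_
  rw [sub_le_iff_le_add]
  have := Qb_le (p := p) (Ω := Ω) hv x y.2
  have := hK x hx x' hx' y (hYB y.2)
  linarith

theorem Qbhat_lipschitzOnWith {B A : Set X} {K : ℝ≥0} {w : X → ℝ} (hAB : A ⊆ B)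
    (hK : ∀ x ∈ B, ∀ x' ∈ B, ∀ y ∈ B, bdist p Ω x y ^ p ≤ bdist p Ω x' y ^ p + K * dist x x') :
    LipschitzOnWith K (Qbhat p Ω A w) B := by
  have key : ∀ y ∈ B, ∀ y' ∈ B, ∀ x : A,
      w x - bdist p Ω x y ^ p ≤ w x - bdist p Ω x y' ^ p + K * dist y y' := by
    intro y hy y' hy' x
    have := hK y' hy' y hy x (hAB x.2)
    rw [bdist_comm, bdist_comm y, dist_comm] at this
    linarith
  have hbdd : ∀ y ∈ B, ∀ y' ∈ B, BddAbove (range fun x : A => w x - bdist p Ω x y ^ p) →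
      BddAbove (range fun x : A => w x - bdist p Ω x y' ^ p) := by
    rintro y hy y' hy' ⟨M, hM⟩
    refine ⟨M + K * dist y' y, ?_⟩
    rintro _ ⟨x, rfl⟩
    have h1 := hM (mem_range_self x)
    have h2 := key y' hy' y hy x
    simp only at h1 ⊢
    linarith
  refine LipschitzOnWith.of_le_add_mul K fun y hy y' hy' => ?_
  rcases isEmpty_or_nonempty A with hA | hA
  · simp only [Qbhat, Real.iSup_of_isEmpty, zero_add]; positivity
  by_cases h : BddAbove (range fun x : A => w x - bdist p Ω x y' ^ p)
  · refine ciSup_le fun x => ?_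
    have h1 := le_ciSup h x
    have h2 := key y hy y' hy' x
    simp only [Qbhat]
    linarith
  · have h' := mt (hbdd y hy y' hy') h
    simp only [Qbhat]
    rw [Real.iSup_of_not_bddAbove h, Real.iSup_of_not_bddAbove h']
    positivity

/-- If a pair realises the dual constraint with equality and its first point is deep enough
inside `Ω`, then transporting it directly is at least as cheap as using the boundary. -/
theorem bdist_rpow_eq_dist_rpow_of_mem_innerPart {XX Y : Set X} {v : X → ℝ} (hp : 0 < p)
    (hX : IsCompact XX) (hYne : Y.Nonempty) (hY : IsCompact Y) (hv : ContinuousOn v Y)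
    (hΩX : Ω ⊆ XX) {x y : X} (hy : y ∈ Y)
    (heq : Qb p Ω Y v x = v y + bdist p Ω x y ^ p)
    (hx : x ∈ innerPart Ω ((oscOn Y v + supInfDist XX Y ^ p) ^ (1 / p))) :
    bdist p Ω x y ^ p = dist x y ^ p := by
  have himg := hY.image_of_continuousOn hv
  rw [bdist_rpow hp, min_eq_left_iff]
  by_contra! hlt
  obtain ⟨y₀, hy₀, hdist⟩ := hY.exists_infDist_eq_dist hYne x
  have h1 : Qb p Ω Y v x ≤ v y₀ + dist x y₀ ^ p := by
    refine (Qb_le himg.bddBelow x hy₀).trans ?_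
    rw [bdist_rpow hp]
    gcongr
    exact min_le_left _ _
  have h2 : infDist x Y ≤ supInfDist XX Y :=
    le_csSup (hX.image (continuous_infDist_pt Y)).bddAbove (mem_image_of_mem _ (hΩX hx.1))
  have h3 : dist x y₀ ^ p ≤ supInfDist XX Y ^ p := by
    rw [← hdist]
    exact Real.rpow_le_rpow infDist_nonneg h2 hp.le
  have h4 : v y₀ - v y ≤ oscOn Y v :=
    sub_le_sub (le_csSup himg.bddAbove (mem_image_of_mem v hy₀))
      (csInf_le himg.bddBelow (mem_image_of_mem v hy))
  rw [heq, bdist_rpow hp, min_eq_right hlt.le] at h1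
  have h5 : infDist x Ωᶜ ^ p ≤ oscOn Y v + supInfDist XX Y ^ p := by
    have := Real.rpow_nonneg (infDist_nonneg (x := y) (s := Ωᶜ)) p
    linarith
  have h6 := Real.rpow_le_rpow (Real.rpow_nonneg infDist_nonneg p) h5 (one_div_nonneg.2 hp.le)
  rw [one_div, Real.rpow_rpow_inv infDist_nonneg hp.ne'] at h6
  have h7 := hx.2
  rw [one_div] at h7
  exact absurd h7 (not_lt.2 h6)

end BoundaryCost

section Gradient

variable {F : Type*} [NormedAddCommGroup F] [InnerProductSpace ℝ F] [CompleteSpace F]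

theorem HasGradientAt.norm_le_of_sub_le_rpow {f : F → ℝ} {g x : F} {p a : ℝ} (hp : 1 < p)
    (ha : 0 ≤ a) (hf : HasGradientAt f g x)
    (h : ∀ x', f x' - f x ≤ (a + dist x' x) ^ p - a ^ p) : ‖g‖ ≤ p * a ^ (p - 1) := by
  have hline : HasDerivAt (fun t : ℝ => x + t • g) g 0 := by
    simpa using ((hasDerivAt_id (0 : ℝ)).smul_const g).const_add x
  have hφ : HasDerivAt (fun t : ℝ => f (x + t • g)) (‖g‖ ^ 2) 0 := by
    have hf' : HasFDerivAt f (InnerProductSpace.toDual ℝ F g) (x + (0 : ℝ) • g) := by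
      simpa using hf.hasFDerivAt
    have := hf'.comp_hasDerivAt (0 : ℝ) hline
    rw [InnerProductSpace.toDual_apply_apply, real_inner_self_eq_norm_sq] at this
    exact this
  have hψ : HasDerivAt (fun t : ℝ => (a + t * ‖g‖) ^ p) (‖g‖ * p * a ^ (p - 1)) 0 := by
    have h0 : HasDerivAt (fun t : ℝ => a + t * ‖g‖) ‖g‖ 0 := by
      simpa using ((hasDerivAt_id (0 : ℝ)).mul_const ‖g‖).const_add a
    simpa using h0.rpow_const (p := p) (Or.inr hp.le)
  have hlim := (hψ.sub hφ).tendsto_slope_zero_right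
  have hnn : 0 ≤ ‖g‖ * p * a ^ (p - 1) - ‖g‖ ^ 2 := by
    refine ge_of_tendsto hlim ?_
    filter_upwards [self_mem_nhdsWithin] with t ht
    have ht : 0 < t := ht
    have := h (x + t • g)
    rw [dist_self_add_left, norm_smul, Real.norm_of_nonneg ht.le] at this
    refine smul_nonneg (inv_nonneg.2 ht.le) ?_
    simp only [Pi.sub_apply, zero_add, zero_mul, zero_smul, add_zero]
    linarith
  rcases (norm_nonneg g).eq_or_lt with h0 | h0
  · rw [← h0]; positivity
  · refine le_of_mul_le_mul_left ?_ h0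
    nlinarith

theorem HasGradientAt.norm_rpow_le_bdist_rpow {f : F → ℝ} {g x y : F} {p : ℝ} {Ω : Set F}
    (hp : 1 < p) (hf : HasGradientAt f g x)
    (h : ∀ x', f x' - f x ≤ bdist p Ω x' y ^ p - bdist p Ω x y ^ p) :
    ‖g‖ ^ (p / (p - 1)) ≤ p ^ (p / (p - 1)) * bdist p Ω x y ^ p := by
  have hp0 : 0 < p := zero_lt_one.trans hp
  have hp1 : 0 < p - 1 := sub_pos.2 hp
  obtain ⟨a, ha, hab, hgrow⟩ := exists_bdist_rpow_sub_le (Ω := Ω) hp0 x y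
  have h1 := hf.norm_le_of_sub_le_rpow hp ha fun x' => (h x').trans (hgrow x')
  have h2 : ‖g‖ ≤ p * bdist p Ω x y ^ (p - 1) := h1.trans (by gcongr)
  have hb := bdist_nonneg (p := p) (Ω := Ω) x y
  calc ‖g‖ ^ (p / (p - 1))
      ≤ (p * bdist p Ω x y ^ (p - 1)) ^ (p / (p - 1)) := by gcongr
    _ = p ^ (p / (p - 1)) * bdist p Ω x y ^ p := by
      rw [Real.mul_rpow hp0.le (Real.rpow_nonneg hb _), ← Real.rpow_mul hb,
        mul_div_cancel₀ _ hp1.ne']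

theorem HasGradientAt.eq_of_sub_le_dist_rpow {f : F → ℝ} {g x y : F} {p : ℝ} (hp : 1 < p)
    (hf : HasGradientAt f g x) (h : ∀ x', f x' - f x ≤ dist x' y ^ p - dist x y ^ p) :
    g = (p * ‖x - y‖ ^ (p - 2)) • (x - y) := by
  have hmin : IsLocalMin (fun x' => ‖x' - y‖ ^ p - f x') x :=
    Eventually.of_forall fun x' => by
      have := h x'
      simp only [dist_eq_norm] at this
      linarith
  have hpow := (hasFDerivAt_norm_rpow (x - y) hp).comp x ((hasFDerivAt_id x).sub_const y)
  have hzero := hmin.hasFDerivAt_eq_zero (hpow.sub hf.hasFDerivAt)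
  refine (ext_inner_right ℝ fun w => ?_)
  have := DFunLike.congr_fun hzero w
  simp only [sub_apply, ContinuousLinearMap.comp_apply,
    smul_apply, ContinuousLinearMap.id_apply, innerSL_apply_apply,
    InnerProductSpace.toDual_apply_apply, smul_eq_mul, zero_apply] at this
  rw [real_inner_smul_left]
  linarith

end Gradient

theorem vpow_smul_norm_rpow_smul {d : ℕ} {p : ℝ} (hp : 1 < p) (z : EuclideanSpace ℝ (Fin d)) :
    vpow (p⁻¹ • (p * ‖z‖ ^ (p - 2)) • z) ((p / (p - 1)) / p) = z := by
  have hp0 : p ≠ 0 := by linarith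
  have hp1 : p - 1 ≠ 0 := by linarith
  rcases eq_or_ne z 0 with rfl | hz
  · simp [vpow]
  have hz' : 0 < ‖z‖ := norm_pos_iff.2 hz
  rw [smul_smul, inv_mul_cancel_left₀ hp0, vpow, norm_smul,
    Real.norm_of_nonneg (Real.rpow_nonneg hz'.le _), smul_smul, ← Real.rpow_add_one hz'.ne',
    ← Real.rpow_mul hz'.le, ← Real.rpow_add hz']
  have : (p - 2 + 1) * (p / (p - 1) / p - 1) + (p - 2) = 0 := by
    field_simp; ring
  rw [this, Real.rpow_zero, one_smul]

theorem ae_differentiableAt_of_lipschitzOnWith_ball {d : ℕ} {K : ℝ≥0} {R : ℝ}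
    {f : EuclideanSpace ℝ (Fin d) → ℝ} (hf : LipschitzOnWith K f (ball 0 R)) :
    ∀ᵐ x, x ∈ ball (0 : EuclideanSpace ℝ (Fin d)) R → DifferentiableAt ℝ f x := by
  filter_upwards [hf.ae_differentiableWithinAt_of_mem (μ := volume)] with x hx hxR
  exact (hx hxR).differentiableAt (isOpen_ball.mem_nhds hxR)

/-- Complementary slackness for a nonnegative cost: dual admissible potentials whose dual value
equals the primal cost saturate the constraint almost everywhere. -/
theorem ae_eq_of_dual_value_eq {X : Type*} [MeasurableSpace X] {μ lam : Measure X}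
    {π : Measure (X × X)} {c : X × X → ℝ} {f g : X → ℝ} (hπ : π ∈ couplings μ lam)
    (hc : Integrable c π) (hf : Integrable f lam) (hg : Integrable g μ)
    (hle : ∀ᵐ z ∂π, f z.1 ≤ g z.2 + c z)
    (hval : (∫ x, f x ∂lam) - (∫ y, g y ∂μ) = ∫ z, c z ∂π) :
    ∀ᵐ z ∂π, f z.1 = g z.2 + c z := by
  obtain ⟨rfl, rfl⟩ := hπ
  have hf' : Integrable (fun z : X × X => f z.1) π := hf.comp_measurable measurable_fst
  have hg' : Integrable (fun z : X × X => g z.2) π := hg.comp_measurable measurable_snd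
  rw [integral_map measurable_fst.aemeasurable hf.aestronglyMeasurable,
    integral_map measurable_snd.aemeasurable hg.aestronglyMeasurable] at hval
  have hgc : Integrable (fun z : X × X => g z.2 + c z) π := hg'.add hc
  have hzero : ∫ z, (g z.2 + c z - f z.1) ∂π = 0 := by
    rw [integral_sub hgc hf', integral_add hg' hc]
    linarith
  have := (integral_eq_zero_iff_of_nonneg_ae (by
    filter_upwards [hle] with z hz
    simp only [Pi.zero_apply, Pi.sub_apply]
    linarith) (hgc.sub hf')).1 hzero
  filter_upwards [this] with z hz
  simp only [Pi.zero_apply, Pi.sub_apply] at hz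
  linarith

/-- boundary Brenier-type theorem: let `X ⊂ ℝ^d` be compact convex,
`Ω ⊆ X` Borel, `p > 1`, `p' = p/(p−1)`, `μ, λ` with `λ(Ω) = μ(Ω)`, `λ` absolutely
continuous, `μ` supported on a closed `Y ⊆ X`, and let `π`, `v` be primal/dual optimizers
of `Wb^p_Ω(μ,λ)`. With `u := Q_{b_Ω^p}(v)` and `ℓ := (osc_Y(v) + d(X,Y)^p)^{1/p}`:
`∫_Ω |∇u|^{p'} dλ ≤ p^{p'} Wb^p_Ω(μ,λ)`, and for π-a.e. `(x,y)`, if `x ∈ Ω^{(ℓ)}` then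
`y = x − (∇u(x)/p)^{(p'/p)}`. -/
theorem boundary_brenier
    (d : ℕ) (p : ℝ) (hp : 1 < p)
    (XX : Set (EuclideanSpace ℝ (Fin d))) (hXc : IsCompact XX) (hXconv : Convex ℝ XX)
    (Ω : Set (EuclideanSpace ℝ (Fin d))) (hΩX : Ω ⊆ XX) (hΩm : MeasurableSet Ω)
    (μ lam : Measure (EuclideanSpace ℝ (Fin d)))
    [IsFiniteMeasure μ] [IsFiniteMeasure lam]
    (hac : lam ≪ volume) (hmass : lam Ω = μ Ω)
    (Y : Set (EuclideanSpace ℝ (Fin d))) (hYc : IsClosed Y) (hYX : Y ⊆ XX) (hsupp : μ Yᶜ = 0)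
    (π : Measure (EuclideanSpace ℝ (Fin d) × EuclideanSpace ℝ (Fin d)))
    (hπ : π ∈ couplings (μ.restrict Ω) (lam.restrict Ω))
    (hπopt : (∫⁻ z, ENNReal.ofReal (bdist p Ω z.1 z.2 ^ p) ∂π) =
      transportCostE (fun x y => bdist p Ω x y ^ p) (μ.restrict Ω) (lam.restrict Ω))
    (v : EuclideanSpace ℝ (Fin d) → ℝ) (hvS : memS p Ω XX Y v)
    (hvopt : (∫ x, Qb p Ω Y v x ∂(lam.restrict Ω)) - (∫ y, v y ∂(μ.restrict Ω)) =
      Wb p Ω μ lam)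
    (u : EuclideanSpace ℝ (Fin d) → ℝ) (hu : u = Qb p Ω Y v)
    (ℓ : ℝ) (hℓ : ℓ = (oscOn Y v + supInfDist XX Y ^ p) ^ (1 / p)) :
    (∫ x in Ω, ‖gradient u x‖ ^ (p / (p - 1)) ∂lam) ≤ p ^ (p / (p - 1)) * Wb p Ω μ lam ∧
    ∀ᵐ z ∂π, z.1 ∈ innerPart Ω ℓ →
      z.2 = z.1 - vpow (p⁻¹ • gradient u z.1) ((p / (p - 1)) / p) := by
  have hp0 : 0 < p := zero_lt_one.trans hp
  obtain ⟨R, hR⟩ := hXc.isBounded.subset_ball 0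
  obtain ⟨K, hK⟩ := exists_bdist_rpow_le_add (Ω := Ω) hp
    (isBounded_ball (x := (0 : EuclideanSpace ℝ (Fin d))) (r := R))
  have hY : IsCompact Y := hXc.of_isClosed_subset hYc hYX
  have hvc : ContinuousOn v Y := by
    obtain ⟨w, hw⟩ := hvS
    exact ((Qbhat_lipschitzOnWith hR hK).continuousOn.mono (hYX.trans hR)).congr hw
  have hvbdd : BddBelow (v '' Y) := (hY.image_of_continuousOn hvc).bddBelow
  have hulip : LipschitzOnWith K u (ball 0 R) :=
    hu ▸ Qb_lipschitzOnWith (hYX.trans hR) hK hvbdd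
  have huint : Integrable u (lam.restrict Ω) :=
    ((hulip.continuousOn.mono hR).integrableOn_compact hXc).mono_set hΩX
  have hvint : Integrable v (μ.restrict Ω) := by
    have h1 : IntegrableOn v Y μ := hvc.integrableOn_compact hY
    have hYae : ∀ᵐ y ∂μ, y ∈ Y := hsupp
    rw [IntegrableOn, Measure.restrict_eq_self_of_ae_mem hYae] at h1
    exact h1.restrict
  have hfst : ∀ {P : EuclideanSpace ℝ (Fin d) → Prop}, (∀ᵐ x ∂lam.restrict Ω, P x) →
      ∀ᵐ z ∂π, P z.1 := fun h =>
    ae_of_ae_map measurable_fst.aemeasurable (by rw [hπ.1]; exact h)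
  have hsnd : ∀ {P : EuclideanSpace ℝ (Fin d) → Prop}, (∀ᵐ y ∂μ.restrict Ω, P y) →
      ∀ᵐ z ∂π, P z.2 := fun h =>
    ae_of_ae_map measurable_snd.aemeasurable (by rw [hπ.2]; exact h)
  have hxΩ : ∀ᵐ z ∂π, z.1 ∈ Ω := hfst (ae_restrict_mem hΩm)
  have hyY : ∀ᵐ z ∂π, z.2 ∈ Y := hsnd (ae_restrict_of_ae hsupp)
  have hdiff : ∀ᵐ z ∂π, DifferentiableAt ℝ u z.1 := by
    have h1 := hfst (ae_restrict_of_ae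
      (hac.ae_le (ae_differentiableAt_of_lipschitzOnWith_ball hulip)))
    filter_upwards [h1, hxΩ] with z hz hzΩ
    exact hz (hR (hΩX hzΩ))
  have : IsFiniteMeasure π := by
    constructor
    have h1 : (π.map Prod.fst) univ = π univ := by
      rw [Measure.map_apply measurable_fst MeasurableSet.univ, preimage_univ]
    rw [← h1, hπ.1]
    exact measure_lt_top _ _
  have hccont := continuous_bdist_rpow (X := EuclideanSpace ℝ (Fin d)) (Ω := Ω) hp0
  have hcint : Integrable (fun z => bdist p Ω z.1 z.2 ^ p) π := by
    obtain ⟨M, hM⟩ := (hXc.prod hXc).exists_bound_of_continuousOn hccont.continuousOn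
    refine Integrable.of_bound hccont.aestronglyMeasurable M ?_
    filter_upwards [hxΩ, hyY] with z hz1 hz2
    exact hM z ⟨hΩX hz1, hYX hz2⟩
  have hWb : Wb p Ω μ lam = ∫ z, bdist p Ω z.1 z.2 ^ p ∂π := by
    have hnonneg : 0 ≤ᵐ[π] fun z => bdist p Ω z.1 z.2 ^ p :=
      Eventually.of_forall fun z => bdist_rpow_nonneg (p := p) (Ω := Ω) z.1 z.2
    have h1 := integral_eq_lintegral_of_nonneg_ae hnonneg hcint.aestronglyMeasurable
    rw [h1, hπopt, Wb, transportCost]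
  have hle : ∀ x, ∀ y ∈ Y, u x ≤ v y + bdist p Ω x y ^ p := fun x y hy =>
    hu ▸ Qb_le hvbdd x hy
  have hslack : ∀ᵐ z ∂π, u z.1 = v z.2 + bdist p Ω z.1 z.2 ^ p := by
    refine ae_eq_of_dual_value_eq hπ hcint huint hvint ?_ ?_
    · filter_upwards [hyY] with z hz using hle _ _ hz
    · rw [← hWb, ← hvopt, hu]
  refine ⟨?_, ?_⟩
  · have hgrad : ∀ᵐ z ∂π, ‖gradient u z.1‖ ^ (p / (p - 1)) ≤
        p ^ (p / (p - 1)) * bdist p Ω z.1 z.2 ^ p := by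
      filter_upwards [hyY, hdiff, hslack] with z hzY hzd hz
      exact hzd.hasGradientAt.norm_rpow_le_bdist_rpow hp fun x' => by
        linarith [hle x' z.2 hzY]
    by_cases hint : Integrable (fun x => ‖gradient u x‖ ^ (p / (p - 1))) (lam.restrict Ω)
    · rw [hWb, ← integral_const_mul, ← hπ.1]
      rw [← hπ.1] at hint
      rw [integral_map measurable_fst.aemeasurable hint.aestronglyMeasurable]
      exact integral_mono_ae (hint.comp_measurable measurable_fst) (hcint.const_mul _) hgrad
    · rw [integral_undef hint]
      exact mul_nonneg (Real.rpow_nonneg hp0.le _) ENNReal.toReal_nonneg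
  · filter_upwards [hyY, hdiff, hslack] with z hzY hzd hz hzℓ
    rw [hℓ] at hzℓ
    have hdist := bdist_rpow_eq_dist_rpow_of_mem_innerPart hp0 hXc ⟨_, hzY⟩ hY hvc hΩX hzY
      (hu ▸ hz) hzℓ
    have hgrad := hzd.hasGradientAt.eq_of_sub_le_dist_rpow (y := z.2) hp fun x' => by
      have h1 := hle x' z.2 hzY
      have h2 : bdist p Ω x' z.2 ^ p ≤ dist x' z.2 ^ p := by
        rw [bdist_rpow hp0]; exact min_le_left _ _
      linarith
    rw [hgrad, vpow_smul_norm_rpow_smul hp, sub_sub_cancel]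

end
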